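/- ∫_0^∞ η(ix)^4 dx = 2^{-5/6} · (√5 − 1)^{5/6} · ₂F₁(1/6, 1/6; 1; (−123 + 55√5)/2). -/

import Mathlib

open MeasureTheory Real

/-- Euler's product `f(-q) = ∏_{n=1}^∞ (1 - qⁿ)`. -/
noncomputable def eulerF (q : ℝ) : ℝ := ∏' n : ℕ, (1 - q ^ (n + 1))

/-- Gauss hypergeometric series `₂F₁(a, b; c; z)`. -/
noncomputable def hyp2F1 (a b c z : ℝ) : ℝ :=
  ∑' n : ℕ, ((ascPochhammer ℝ n).eval a * (ascPochhammer ℝ n).eval b /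
    (ascPochhammer ℝ n).eval c) * z ^ n / n.factorial

/-- The Dedekind eta function on the imaginary axis: `η(ix)` for `x > 0`. -/
noncomputable def etaI (x : ℝ) : ℝ :=
  Real.exp (-(π * x) / 12) * ∏' n : ℕ, (1 - Real.exp (-(2 * π * (n + 1) * x)))

theorem rpow_neg_five_sixths_1728 : (1728 : ℝ) ^ (-5 / 6 : ℝ) = 2 * √3 / 1728 := by
  rw [show (1728 : ℝ) = (2 * √3) ^ 6 by
    rw [mul_pow, show √3 ^ 6 = (√3 ^ 2) ^ 3 by ring, Real.sq_sqrt (by norm_num)]; norm_num,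
    ← Real.rpow_natCast, ← Real.rpow_mul (by positivity), eq_div_iff (by positivity),
    ← Real.rpow_add (by positivity)]
  norm_num

section ModularForms

open UpperHalfPlane ModularForm EisensteinSeries Derivative Filter Topology
open scoped MatrixGroups Manifold Modular

/-- A function on the upper half plane given by a `q`-series tends to the constant coefficient. -/
theorem tendsto_atImInfty_of_hasSum {f : ℍ → ℂ} {c : ℕ → ℂ}
    (hf : ∀ τ : ℍ, HasSum (fun m ↦ c m • Function.Periodic.qParam 1 τ ^ m) (f τ)) :
    Tendsto f atImInfty (𝓝 (c 0)) := by
  have hq := qParam_tendsto_atImInfty one_pos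
  have hev : ∀ᶠ τ : ℍ in atImInfty,
      ‖Function.Periodic.qParam 1 (τ : ℂ)‖ ≤ ‖Function.Periodic.qParam 1 (UpperHalfPlane.I : ℂ)‖ := by
    have h0 : 0 < ‖Function.Periodic.qParam 1 (UpperHalfPlane.I : ℂ)‖ :=
      norm_pos_iff.mpr (Function.Periodic.qParam_ne_zero _)
    filter_upwards [(tendsto_norm_zero.comp hq).eventually (gt_mem_nhds h0)] with τ hτ
    exact hτ.le
  have hlim := tendsto_tsum_of_dominated_convergence (𝓕 := (atImInfty : Filter ℍ))
    (f := fun τ m ↦ c m • Function.Periodic.qParam 1 τ ^ m)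
    (g := fun m ↦ c m • (0 : ℂ) ^ m)
    (hf UpperHalfPlane.I).summable.norm
    (fun m ↦ (hq.pow m).const_smul (c m))
    (by
      filter_upwards [hev] with τ hτ m
      simp only [norm_smul, norm_pow]
      gcongr)
  rw [tsum_eq_single 0 (by intro m hm; simp [hm])] at hlim
  simp_rw [(hf _).tsum_eq] at hlim
  simpa using hlim

/-- The `q`-expansion of the Eisenstein series of weight `k`. -/
theorem hasSum_E {k : ℕ} (hk : 3 ≤ k) (hk2 : Even k) (τ : ℍ) :
    HasSum (fun m ↦ (if m = 0 then 1 else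
      -(2 * k / bernoulli k : ℂ) * (ArithmeticFunction.sigma (k - 1) m)) •
        Function.Periodic.qParam 1 τ ^ m) (E hk τ) := by
  simpa only [E_qExpansion_coeff hk hk2] using
    hasSum_qExpansion one_pos (SlashInvariantFormClass.periodic_comp_ofComplex (E hk)
      one_mem_strictPeriods_SL) (ModularFormClass.holo (E hk))
      (ModularFormClass.bdd_at_infty (E hk)) τ

theorem tendsto_E_atImInfty {k : ℕ} (hk : 3 ≤ k) (hk2 : Even k) :
    Tendsto (E hk) atImInfty (𝓝 1) := by
  simpa using tendsto_atImInfty_of_hasSum (hasSum_E hk hk2)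

theorem tendsto_E2_atImInfty : Tendsto E2 atImInfty (𝓝 1) := by
  have := tendsto_atImInfty_of_hasSum (f := E2) fun τ ↦ by
    simpa only [Function.Periodic.qParam, Complex.ofReal_one, div_one] using
      hasSum_qExpansion_E2 (z := τ)
  rwa [if_pos rfl] at this

theorem normalizedDeriv_eq_cuspFunction {k : ℤ} (F : ModularForm 𝒮ℒ k) (τ : ℍ) :
    normalizedDerivOfComplex F τ = Function.Periodic.qParam 1 τ *
      deriv (cuspFunction 1 F) (Function.Periodic.qParam 1 τ) := by
  have heq : (F ∘ ofComplex : ℂ → ℂ) =ᶠ[𝓝 (τ : ℂ)]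
      fun w ↦ cuspFunction 1 F (Function.Periodic.qParam 1 w) := by
    filter_upwards [isOpen_upperHalfPlaneSet.mem_nhds τ.im_pos] with w hw
    have := SlashInvariantFormClass.eq_cuspFunction F (⟨w, hw⟩ : ℍ) one_mem_strictPeriods_SL
      one_ne_zero
    simpa [ofComplex_apply_of_im_pos hw] using this.symm
  have hd : HasDerivAt (Function.Periodic.qParam 1)
      (2 * π * Complex.I * Function.Periodic.qParam 1 τ) (τ : ℂ) := by
    have := (((hasDerivAt_id (τ : ℂ)).const_mul (2 * π * Complex.I)).div_const ((1 : ℝ) : ℂ)).cexp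
    refine this.congr_deriv ?_
    simp [Function.Periodic.qParam, mul_comm]
  have hc := (ModularFormClass.differentiableAt_cuspFunction F one_pos one_mem_strictPeriods_SL
    (Function.Periodic.norm_qParam_lt_one one_pos τ.im_pos)).hasDerivAt
  have := (hc.comp (τ : ℂ) hd).congr_of_eventuallyEq heq
  rw [normalizedDerivOfComplex, this.deriv]
  have : (2 * π * Complex.I : ℂ) ≠ 0 := Complex.two_pi_I_ne_zero
  field_simp

theorem normalizedDeriv_isZeroAtImInfty {k : ℤ} (F : ModularForm 𝒮ℒ k) :
    IsZeroAtImInfty (normalizedDerivOfComplex F) := by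
  have hq := qParam_tendsto_atImInfty one_pos
  have hc := (ModularFormClass.analyticAt_cuspFunction_zero F one_pos
    one_mem_strictPeriods_SL).deriv.continuousAt.tendsto.comp hq
  have := hq.mul hc
  rw [zero_mul] at this
  exact this.congr fun τ ↦ (normalizedDeriv_eq_cuspFunction F τ).symm

/-- The Serre derivative of a level one modular form, as a modular form. -/
noncomputable def serreDerivativeForm {k : ℤ} (F : ModularForm 𝒮ℒ k) :
    ModularForm 𝒮ℒ (k + 2) where
  toFun := serreDerivative k F
  slash_action_eq' A hA := by
    obtain ⟨A, rfl⟩ := hA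
    exact serreDerivative_slash_invariant F.holo' (F.slash_action_eq' _ ⟨A, rfl⟩)
  holo' := serreDerivative_mdifferentiable _ F.holo'
  bdd_at_cusps' hc := by
    rw [Subgroup.IsArithmetic.isCusp_iff_isCusp_SL2Z] at hc
    rw [OnePoint.isBoundedAt_iff_forall_SL2Z hc]
    intro γ _
    have hγ : serreDerivative k F ∣[k + 2] γ = serreDerivative k F :=
      serreDerivative_slash_invariant F.holo' (F.slash_action_eq' _ ⟨γ, rfl⟩)
    rw [hγ]
    have hF : IsBoundedAtImInfty F := ModularFormClass.bdd_at_infty F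
    exact Asymptotics.IsBigO.sub (normalizedDeriv_isZeroAtImInfty F).boundedAtFilter
      (BoundedAtFilter.mul (isBoundedAtImInfty_E2.const_mul_left (k * 12⁻¹ : ℂ)) hF)

theorem serreDerivativeForm_apply {k : ℤ} (F : ModularForm 𝒮ℒ k) (τ : ℍ) :
    serreDerivativeForm F τ = normalizedDerivOfComplex F τ - k * 12⁻¹ * E2 τ * F τ := rfl

theorem tendsto_serreDerivativeForm_E {k : ℕ} (hk : 3 ≤ k) (hk2 : Even k) :
    Tendsto (serreDerivativeForm (E hk)) atImInfty (𝓝 (-(k / 12))) := by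
  have := (normalizedDeriv_isZeroAtImInfty (E hk)).sub
    ((tendsto_E2_atImInfty.const_mul ((k : ℤ) * 12⁻¹ : ℂ)).mul (tendsto_E_atImInfty hk hk2))
  refine (this.congr fun τ ↦ (serreDerivativeForm_apply (E hk) τ).symm).trans_eq ?_
  congr 1
  push_cast
  ring

theorem levelOne_weight_eight_rank_one : Module.rank ℂ (ModularForm 𝒮ℒ 8) = 1 := by
  have := dimension_level_one 8 ⟨4, rfl⟩
  simpa [Nat.ModEq] using this

/-- Ramanujan's differential equation for `E₄`. -/
theorem normalizedDeriv_E₄ (τ : ℍ) :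
    normalizedDerivOfComplex E₄ τ = (E2 τ * E₄ τ - E₆ τ) / 3 := by
  obtain ⟨c, hc⟩ := (finrank_eq_one_iff_of_nonzero' E₆ (E_ne_zero _ ⟨3, rfl⟩)).mp
    (Module.rank_eq_one_iff_finrank_eq_one.mp levelOne_weight_six_rank_one)
    (ModularForm.mcast (by norm_num) (serreDerivativeForm E₄))
  have hc' (τ : ℍ) : c * E₆ τ = serreDerivativeForm E₄ τ := DFunLike.congr_fun hc τ
  have h1 := (tendsto_E_atImInfty (k := 6) (by norm_num) ⟨3, rfl⟩).const_mul c
  have h2 := (tendsto_serreDerivativeForm_E (k := 4) (by norm_num) ⟨2, rfl⟩).congr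
    fun τ ↦ (hc' τ).symm
  have hcc := tendsto_nhds_unique h1 h2
  have := hc' τ
  rw [serreDerivativeForm_apply] at this
  push_cast at this hcc
  linear_combination -this + E₆ τ * hcc

/-- Ramanujan's differential equation for `E₆`. -/
theorem normalizedDeriv_E₆ (τ : ℍ) :
    normalizedDerivOfComplex E₆ τ = (E2 τ * E₆ τ - E₄ τ ^ 2) / 2 := by
  have hne : ModularForm.mcast (by norm_num : (4 + 4 : ℤ) = 8) (E₄.mul E₄) ≠ 0 := by
    intro h
    have h1 : Tendsto (fun τ ↦ E₄ τ * E₄ τ) atImInfty (𝓝 (1 * 1)) :=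
      (tendsto_E_atImInfty (k := 4) (by norm_num) ⟨2, rfl⟩).mul
        (tendsto_E_atImInfty (k := 4) (by norm_num) ⟨2, rfl⟩)
    have h2 : (fun τ ↦ E₄ τ * E₄ τ) = fun _ ↦ 0 := funext fun τ ↦ DFunLike.congr_fun h τ
    rw [h2] at h1
    simpa using tendsto_nhds_unique h1 tendsto_const_nhds
  obtain ⟨c, hc⟩ := (finrank_eq_one_iff_of_nonzero' _ hne).mp
    (Module.rank_eq_one_iff_finrank_eq_one.mp levelOne_weight_eight_rank_one)
    (ModularForm.mcast (by norm_num) (serreDerivativeForm E₆))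
  have hc' (τ : ℍ) : c * (E₄ τ * E₄ τ) = serreDerivativeForm E₆ τ := DFunLike.congr_fun hc τ
  have h1 := ((tendsto_E_atImInfty (k := 4) (by norm_num) ⟨2, rfl⟩).mul
    (tendsto_E_atImInfty (k := 4) (by norm_num) ⟨2, rfl⟩)).const_mul c
  have h2 := (tendsto_serreDerivativeForm_E (k := 6) (by norm_num) ⟨3, rfl⟩).congr
    fun τ ↦ (hc' τ).symm
  have hcc := tendsto_nhds_unique h1 h2
  have := hc' τ
  rw [serreDerivativeForm_apply] at this
  push_cast at this hcc
  linear_combination -this + E₄ τ ^ 2 * hcc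

end ModularForms

section ImaginaryAxis

open UpperHalfPlane ModularForm EisensteinSeries Derivative Filter Topology
open scoped MatrixGroups Manifold Modular

/-- The real part of a function on the upper half plane along the imaginary axis. -/
noncomputable def reImAxis (F : ℍ → ℂ) (x : ℝ) : ℝ := (F (ofComplex (x * Complex.I))).re

theorem coe_ofComplex_mul_I {x : ℝ} (hx : 0 < x) :
    (ofComplex (x * Complex.I) : ℂ) = x * Complex.I := by
  rw [ofComplex_apply_of_im_pos (by simpa using hx)]

theorem qParam_ofComplex_mul_I {x : ℝ} (hx : 0 < x) :
    Function.Periodic.qParam 1 (ofComplex (x * Complex.I) : ℂ) = (Real.exp (-(2 * π * x)) : ℝ) := by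
  rw [coe_ofComplex_mul_I hx, Function.Periodic.qParam, Complex.ofReal_exp]
  congr 1
  push_cast
  linear_combination (2 * π * x : ℂ) * Complex.I_mul_I

theorem hasSum_reImAxis_E {k : ℕ} (hk : 3 ≤ k) (hk2 : Even k) {x : ℝ} (hx : 0 < x) :
    HasSum (fun m ↦ (if m = 0 then 1 else
      -(2 * k / bernoulli k : ℝ) * (ArithmeticFunction.sigma (k - 1) m)) *
        Real.exp (-(2 * π * x)) ^ m) (reImAxis (E hk) x) := by
  have := Complex.hasSum_re (hasSum_E hk hk2 (ofComplex (x * Complex.I)))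
  rw [reImAxis]
  convert this using 2 with m
  rw [qParam_ofComplex_mul_I hx, ← Complex.ofReal_pow, smul_eq_mul, Complex.re_mul_ofReal]
  congr 1
  split_ifs
  · simp
  · rw [← Complex.ofReal_re (-(2 * k / bernoulli k : ℝ) * (ArithmeticFunction.sigma (k - 1) m))]
    push_cast
    rfl

theorem ofReal_reImAxis_E {k : ℕ} (hk : 3 ≤ k) (hk2 : Even k) {x : ℝ} (hx : 0 < x) :
    (reImAxis (E hk) x : ℂ) = E hk (ofComplex (x * Complex.I)) := by
  have h1 := hasSum_E hk hk2 (ofComplex (x * Complex.I))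
  have h2 := Complex.hasSum_ofReal.mpr (hasSum_reImAxis_E hk hk2 hx)
  refine h2.unique ?_
  convert h1 using 2 with m
  rw [qParam_ofComplex_mul_I hx]
  push_cast
  split_ifs <;> simp

theorem hasDerivAt_reImAxis {k : ℤ} (F : ModularForm 𝒮ℒ k) {x : ℝ} (hx : 0 < x) :
    HasDerivAt (reImAxis F)
      (-(2 * π) * (normalizedDerivOfComplex F (ofComplex (x * Complex.I))).re) x := by
  have h1 : HasDerivAt (fun y : ℝ ↦ (y : ℂ) * Complex.I) Complex.I x := by
    simpa using (Complex.ofRealCLM.hasDerivAt (x := x)).mul_const Complex.I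
  have h2 : DifferentiableAt ℂ (F ∘ ofComplex) (x * Complex.I) := by
    have := mdifferentiableAt_iff.mp (ModularFormClass.holo F (ofComplex (x * Complex.I)))
    rwa [coe_ofComplex_mul_I hx] at this
  have h3 := (h2.hasDerivAt.scomp x h1)
  have h4 := Complex.reCLM.hasFDerivAt.comp_hasDerivAt x h3
  refine h4.congr_deriv ?_
  rw [normalizedDerivOfComplex, coe_ofComplex_mul_I hx]
  have : Complex.I • deriv (F ∘ ofComplex) (x * Complex.I) = ((-(2 * π) : ℝ) : ℂ) *
      ((2 * π * Complex.I)⁻¹ * deriv (F ∘ ofComplex) (x * Complex.I)) := by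
    have : (π : ℂ) ≠ 0 := by exact_mod_cast Real.pi_ne_zero
    field_simp
    push_cast
    linear_combination (2 * π * deriv (F ∘ ofComplex) (x * Complex.I) : ℂ) * Complex.I_mul_I
  rw [this, Complex.reCLM_apply, Complex.re_ofReal_mul]

theorem tendsto_reImAxis_E {k : ℕ} (hk : 3 ≤ k) (hk2 : Even k) :
    Tendsto (reImAxis (E hk)) atTop (𝓝 1) := by
  have h1 : Tendsto (fun x : ℝ ↦ (x : ℂ) * Complex.I) atTop (comap Complex.im atTop) := by
    rw [tendsto_comap_iff]
    exact tendsto_id.congr fun x ↦ by simp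
  have := (Complex.continuous_re.tendsto _).comp
    ((tendsto_E_atImInfty hk hk2).comp (tendsto_comap_im_ofComplex.comp h1))
  exact this

theorem reImAxis_E_inv {k : ℕ} (hk : 3 ≤ k) (hk2 : Even k) {x : ℝ} (hx : 0 < x) :
    reImAxis (E hk) x⁻¹ = (-1) ^ (k / 2) * x ^ k * reImAxis (E hk) x := by
  set z : ℍ := ofComplex (x * Complex.I)
  have hz : (z : ℂ) = x * Complex.I := coe_ofComplex_mul_I hx
  have h := congrFun ((E hk).slash_action_eq' _ ⟨ModularGroup.S, rfl⟩) z
  have h' := (SlashInvariantForm.slash_S_apply (E hk) k z).symm.trans h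
  have hS : (.mk _ z.im_inv_neg_coe_pos : ℍ) = ofComplex ((x⁻¹ : ℝ) * Complex.I) := by
    ext
    rw [coe_ofComplex_mul_I (inv_pos.mpr hx), coe_mk, hz]
    have : (x : ℂ) ≠ 0 := by exact_mod_cast hx.ne'
    push_cast
    field_simp
    simp
  rw [hS, ModularForm.toFun_eq_coe, ← ofReal_reImAxis_E hk hk2 hx,
    ← ofReal_reImAxis_E hk hk2 (inv_pos.mpr hx), hz, zpow_neg,
    mul_inv_eq_iff_eq_mul₀ (zpow_ne_zero _ (by simp [hx.ne'])), zpow_natCast, mul_pow] at h'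
  have hI : Complex.I ^ k = (-1) ^ (k / 2) := by
    rw [← Complex.I_sq, ← pow_mul, Nat.mul_div_cancel' hk2.two_dvd]
  rw [hI] at h'
  apply Complex.ofReal_injective
  rw [h']
  push_cast
  ring

/-- `η(ix)^24 = (E₄(ix)³ - E₆(ix)²) / 1728`. -/
theorem etaI_pow_twentyFour {x : ℝ} (hx : 0 < x) :
    etaI x ^ 24 = (reImAxis E₄ x ^ 3 - reImAxis E₆ x ^ 2) / 1728 := by
  have h := ModularForm.discriminant_eq_E₄_cube_sub_E₆_sq (ofComplex (x * Complex.I))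
  rw [← ofReal_reImAxis_E _ ⟨2, rfl⟩ hx, ← ofReal_reImAxis_E _ ⟨3, rfl⟩ hx] at h
  have h2 : ModularForm.eta (ofComplex (x * Complex.I)) = (etaI x : ℂ) := by
    have hq (n : ℕ) : eta_q n (ofComplex (x * Complex.I) : ℂ) =
        (Real.exp (-(2 * π * (n + 1) * x)) : ℝ) := by
      rw [eta_q_eq_cexp, coe_ofComplex_mul_I hx, Complex.ofReal_exp]
      congr 1
      push_cast
      linear_combination (2 * π * (n + 1) * x : ℂ) * Complex.I_mul_I
    have hp := Topology.IsClosedEmbedding.map_tprod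
      (fun n : ℕ ↦ 1 - Real.exp (-(2 * π * (n + 1) * x)))
      Complex.isometry_ofReal.isClosedEmbedding (L := .unconditional ℕ)
      (g := Complex.ofRealHom)
    rw [ModularForm.eta, etaI, Complex.ofReal_mul]
    congr 1
    · rw [coe_ofComplex_mul_I hx, Function.Periodic.qParam, Complex.ofReal_exp]
      congr 1
      push_cast
      linear_combination (2 * π * x / 24 : ℂ) * Complex.I_mul_I
    · simp_rw [hq]
      refine Eq.trans ?_ hp.symm
      simp
  rw [ModularForm.discriminant, h2] at h
  exact_mod_cast h

theorem one_le_reImAxis_E₄ {x : ℝ} (hx : 0 < x) : 1 ≤ reImAxis E₄ x := by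
  have h := hasSum_reImAxis_E (k := 4) (by norm_num) ⟨2, rfl⟩ hx
  have hb : bernoulli 4 = -1 / 30 := by decide +kernel
  have := h.summable.sum_le_tsum {0} fun m hm ↦ by
    rw [hb, if_neg (by simpa using hm)]
    norm_num
    positivity
  rw [h.tsum_eq] at this
  simpa using this

theorem reImAxis_E₄_pos {x : ℝ} (hx : 0 < x) : 0 < reImAxis E₄ x :=
  zero_lt_one.trans_le (one_le_reImAxis_E₄ hx)

theorem etaI_pow_twentyFour_pos {x : ℝ} (hx : 0 < x) : 0 < etaI x ^ 24 := by
  have h0 : etaI x ^ 24 ≠ 0 := by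
    rw [etaI_pow_twentyFour hx]
    intro h
    apply ModularForm.discriminant_ne_zero (ofComplex (x * Complex.I))
    rw [ModularForm.discriminant_eq_E₄_cube_sub_E₆_sq, ← ofReal_reImAxis_E _ ⟨2, rfl⟩ hx,
      ← ofReal_reImAxis_E _ ⟨3, rfl⟩ hx]
    exact_mod_cast h
  positivity

theorem exists_hasDerivAt_reImAxis {x : ℝ} (hx : 0 < x) : ∃ e : ℝ,
    HasDerivAt (reImAxis E₄)
      (-(2 * π) * ((e * reImAxis E₄ x - reImAxis E₆ x) / 3)) x ∧
    HasDerivAt (reImAxis E₆)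
      (-(2 * π) * ((e * reImAxis E₆ x - reImAxis E₄ x ^ 2) / 2)) x := by
  have h4 := ofReal_reImAxis_E (k := 4) (by norm_num) ⟨2, rfl⟩ hx
  have h6 := ofReal_reImAxis_E (k := 6) (by norm_num) ⟨3, rfl⟩ hx
  refine ⟨(E2 (ofComplex (x * Complex.I))).re, ?_, ?_⟩
  · refine (hasDerivAt_reImAxis E₄ hx).congr_deriv ?_
    rw [normalizedDeriv_E₄, ← h4, ← h6]
    simp
  · refine (hasDerivAt_reImAxis E₆ hx).congr_deriv ?_
    rw [normalizedDeriv_E₆, ← h4, ← h6, ← Complex.ofReal_pow]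
    simp [-Complex.ofReal_pow]

/-- The function `E₆ / E₄ ^ (3 / 2)` along the imaginary axis. -/
noncomputable def eisensteinRatio (x : ℝ) : ℝ := reImAxis E₆ x / reImAxis E₄ x ^ (3 / 2 : ℝ)

theorem hasDerivAt_eisensteinRatio {x : ℝ} (hx : 0 < x) :
    HasDerivAt eisensteinRatio
      (π * (reImAxis E₄ x ^ 3 - reImAxis E₆ x ^ 2) / reImAxis E₄ x ^ (5 / 2 : ℝ)) x := by
  obtain ⟨e, h4, h6⟩ := exists_hasDerivAt_reImAxis hx
  have ha := reImAxis_E₄_pos hx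
  refine (h6.div (h4.rpow_const (p := 3 / 2) (.inl ha.ne'))
    (Real.rpow_pos_of_pos ha _).ne').congr_deriv ?_
  set a := reImAxis E₄ x
  set b := reImAxis E₆ x
  have hs := Real.rpow_pos_of_pos ha (1 / 2)
  have h3 : a ^ (3 / 2 : ℝ) = a * a ^ (1 / 2 : ℝ) := by
    rw [← Real.rpow_one_add' ha.le (by norm_num)]; norm_num
  have h5 : a ^ (5 / 2 : ℝ) = a ^ 2 * a ^ (1 / 2 : ℝ) := by
    rw [← Real.rpow_natCast, ← Real.rpow_add ha]; norm_num
  rw [show (3 / 2 - 1 : ℝ) = 1 / 2 by norm_num, h3, h5]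
  field_simp
  ring

theorem eisensteinRatio_sq {x : ℝ} (hx : 0 < x) :
    1 - eisensteinRatio x ^ 2 = 1728 * etaI x ^ 24 / reImAxis E₄ x ^ 3 := by
  have ha := reImAxis_E₄_pos hx
  have h3 : (reImAxis E₄ x ^ (3 / 2 : ℝ)) ^ 2 = reImAxis E₄ x ^ 3 := by
    rw [← Real.rpow_mul_natCast ha.le, ← Real.rpow_natCast]
    norm_num
  rw [eisensteinRatio, div_pow, h3, etaI_pow_twentyFour hx]
  field_simp

theorem tendsto_eisensteinRatio_atTop : Tendsto eisensteinRatio atTop (𝓝 1) := by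
  have := (tendsto_reImAxis_E (k := 6) (by norm_num) ⟨3, rfl⟩).div
    ((tendsto_reImAxis_E (k := 4) (by norm_num) ⟨2, rfl⟩).rpow_const (p := 3 / 2)
      (.inl one_ne_zero)) (by simp)
  rwa [Real.one_rpow, div_one] at this

theorem eisensteinRatio_inv {x : ℝ} (hx : 0 < x) :
    eisensteinRatio x⁻¹ = -eisensteinRatio x := by
  have ha := reImAxis_E₄_pos hx
  have h6 : (x ^ 4) ^ (3 / 2 : ℝ) = x ^ 6 := by
    rw [← Real.rpow_natCast, ← Real.rpow_mul hx.le, ← Real.rpow_natCast]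
    norm_num
  rw [eisensteinRatio, reImAxis_E_inv _ ⟨2, rfl⟩ hx, reImAxis_E_inv _ ⟨3, rfl⟩ hx]
  norm_num
  rw [Real.mul_rpow (by positivity) ha.le, h6, eisensteinRatio]
  field_simp

theorem tendsto_eisensteinRatio_zero : Tendsto eisensteinRatio (𝓝[>] 0) (𝓝 (-1)) := by
  refine (tendsto_eisensteinRatio_atTop.comp tendsto_inv_nhdsGT_zero).neg.congr' ?_
  filter_upwards [self_mem_nhdsWithin] with x hx
  simp [eisensteinRatio_inv hx]

theorem etaI_pow_four_eq {x : ℝ} (hx : 0 < x) :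
    etaI x ^ 4 = (2 * π * √3)⁻¹ *
      (π * (reImAxis E₄ x ^ 3 - reImAxis E₆ x ^ 2) / reImAxis E₄ x ^ (5 / 2 : ℝ) *
        (1 - eisensteinRatio x ^ 2) ^ (-5 / 6 : ℝ)) := by
  have ha := reImAxis_E₄_pos hx
  have hη := etaI_pow_twentyFour_pos hx
  have hη4 : 0 < etaI x ^ 4 := by
    have : etaI x ≠ 0 := by rintro h; simp [h] at hη
    positivity
  have h1 := etaI_pow_twentyFour hx
  rw [eisensteinRatio_sq hx, show reImAxis E₄ x ^ 3 - reImAxis E₆ x ^ 2 = 1728 * etaI x ^ 24 by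
    rw [h1]; ring]
  set a := reImAxis E₄ x
  set h := etaI x ^ 4
  rw [show etaI x ^ 24 = h ^ 6 by rw [← pow_mul]]
  have hh : (h ^ 6) ^ (-5 / 6 : ℝ) = (h ^ 5)⁻¹ := by
    rw [← Real.rpow_natCast, ← Real.rpow_mul hη4.le, ← Real.rpow_natCast, ← Real.rpow_neg hη4.le]
    norm_num
  have haa : (a ^ 3) ^ (-5 / 6 : ℝ) = (a ^ (5 / 2 : ℝ))⁻¹ := by
    rw [← Real.rpow_natCast, ← Real.rpow_mul ha.le, ← Real.rpow_neg ha.le]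
    norm_num
  rw [Real.div_rpow (by positivity) (by positivity), Real.mul_rpow (by norm_num) (by positivity),
    hh, haa, rpow_neg_five_sixths_1728]
  have := Real.rpow_pos_of_pos ha (5 / 2)
  field_simp

end ImaginaryAxis

section ChangeOfVariables

open Filter Topology Set

/-- Change of variables for an increasing bijection onto an interval. -/
theorem setIntegral_deriv_mul_comp {f f' : ℝ → ℝ} {I : Set ℝ} {a b : ℝ} (hI : IsOpen I)
    (hc : Convex ℝ I) (hf : ∀ x ∈ I, HasDerivAt f (f' x) x) (hpos : ∀ x ∈ I, 0 < f' x)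
    (hmaps : MapsTo f I (Ioo a b)) (hsub : Ioo a b ⊆ f '' I) (g : ℝ → ℝ) :
    ∫ x in I, f' x * g (f x) = ∫ u in Ioo a b, g u := by
  have hmono : StrictMonoOn f I := by
    refine strictMonoOn_of_deriv_pos hc (fun x hx ↦ (hf x hx).continuousAt.continuousWithinAt) ?_
    intro x hx
    rw [hI.interior_eq] at hx
    rw [(hf x hx).deriv]
    exact hpos x hx
  rw [← (hmaps.image_subset.antisymm hsub), integral_image_eq_integral_abs_deriv_smul
    hI.measurableSet (fun x hx ↦ (hf x hx).hasDerivWithinAt) hmono.injOn]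
  refine setIntegral_congr_fun hI.measurableSet fun x hx ↦ ?_
  simp [abs_of_pos (hpos x hx)]

end ChangeOfVariables

theorem integral_etaI_pow_four :
    ∫ x in Set.Ioi (0 : ℝ), etaI x ^ 4 =
      (2 * π * √3)⁻¹ * ∫ u in Set.Ioo (-1 : ℝ) 1, (1 - u ^ 2) ^ (-5 / 6 : ℝ) := by
  rw [← setIntegral_deriv_mul_comp isOpen_Ioi (convex_Ioi 0)
    (fun x hx ↦ hasDerivAt_eisensteinRatio hx) ?_ ?_ ?_ (fun u ↦ (1 - u ^ 2) ^ (-5 / 6 : ℝ)),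
    ← integral_const_mul]
  · exact setIntegral_congr_fun measurableSet_Ioi fun x hx ↦ etaI_pow_four_eq hx
  · intro x hx
    have h := etaI_pow_twentyFour hx
    have hη := etaI_pow_twentyFour_pos hx
    have := Real.rpow_pos_of_pos (reImAxis_E₄_pos hx) (5 / 2)
    have : 0 < reImAxis ModularForm.E₄ x ^ 3 - reImAxis ModularForm.E₆ x ^ 2 := by linarith
    positivity
  · intro x hx
    have := etaI_pow_twentyFour_pos hx
    have := reImAxis_E₄_pos hx
    have h : 0 < 1 - eisensteinRatio x ^ 2 := by
      rw [eisensteinRatio_sq hx]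
      positivity
    exact abs_lt.mp ((sq_lt_one_iff_abs_lt_one _).mp (by linarith))
  · exact isPreconnected_Ioi.intermediate_value_Ioo
      (l₁ := nhdsWithin 0 (Set.Ioi 0)) (l₂ := Filter.atTop)
      (Filter.le_principal_iff.mpr self_mem_nhdsWithin)
      (Filter.le_principal_iff.mpr (Filter.Ioi_mem_atTop 0))
      (fun x hx ↦ (hasDerivAt_eisensteinRatio hx).continuousAt.continuousWithinAt)
      tendsto_eisensteinRatio_zero tendsto_eisensteinRatio_atTop

section EulerIntegral

open Set

theorem integrableOn_beta {α β : ℝ} (hα : 0 < α) (hβ : 0 < β) :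
    IntegrableOn (fun v : ℝ ↦ v ^ (α - 1) * (1 - v) ^ (β - 1)) (Ioo 0 1) := by
  have h := Complex.betaIntegral_convergent (u := α) (v := β) (by simpa) (by simpa)
  rw [intervalIntegrable_iff_integrableOn_Ioo_of_le zero_le_one] at h
  refine (integrableOn_congr_fun (fun v hv ↦ ?_) measurableSet_Ioo).mp h.re
  have h1 : ((1 : ℂ) - v) = ((1 - v : ℝ) : ℂ) := by push_cast; rfl
  rw [h1, ← Complex.ofReal_one, ← Complex.ofReal_sub, ← Complex.ofReal_sub,
    ← Complex.ofReal_cpow hv.1.le, ← Complex.ofReal_cpow (by linarith [hv.2]),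
    ← Complex.ofReal_mul]
  simp

theorem integral_beta {α β : ℝ} (hα : 0 < α) (hβ : 0 < β) :
    ∫ v in Ioo (0 : ℝ) 1, v ^ (α - 1) * (1 - v) ^ (β - 1) =
      Gamma α * Gamma β / Gamma (α + β) := by
  have h := ProbabilityTheory.beta_eq_betaIntegralReal α β hα hβ
  rw [ProbabilityTheory.beta] at h
  rw [h, Complex.betaIntegral, intervalIntegral.integral_of_le zero_le_one,
    integral_Ioc_eq_integral_Ioo, ← RCLike.re_eq_complex_re, ← integral_re]
  · refine setIntegral_congr_fun measurableSet_Ioo fun v hv ↦ ?_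
    have h1 : ((1 : ℂ) - v) = ((1 - v : ℝ) : ℂ) := by push_cast; rfl
    rw [h1, ← Complex.ofReal_one, ← Complex.ofReal_sub, ← Complex.ofReal_sub,
      ← Complex.ofReal_cpow hv.1.le, ← Complex.ofReal_cpow (by linarith [hv.2]),
      ← Complex.ofReal_mul]
    simp
  · have h := Complex.betaIntegral_convergent (u := α) (v := β) (by simpa) (by simpa)
    rwa [intervalIntegrable_iff_integrableOn_Ioo_of_le zero_le_one] at h

theorem Gamma_natCast_add {b : ℝ} (hb : 0 < b) (n : ℕ) :
    Gamma (n + b) = (ascPochhammer ℝ n).eval b * Gamma b := by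
  induction n with
  | zero => simp
  | succ n ih =>
    rw [ascPochhammer_succ_eval, Nat.cast_succ, add_right_comm, Gamma_add_one (by positivity), ih]
    ring

theorem choose_add_natCast_sub_one (a : ℝ) (n : ℕ) :
    Ring.choose (a + n - 1) n = (ascPochhammer ℝ n).eval a / n.factorial := by
  have h := Ring.factorial_nsmul_multichoose_eq_ascPochhammer a n
  rw [Polynomial.ascPochhammer_smeval_eq_eval, nsmul_eq_mul] at h
  rw [Ring.choose, eq_div_iff (by positivity), ← h, mul_comm]
  congr 2
  ring

theorem hasSum_one_sub_rpow_neg (a : ℝ) {z : ℝ} (hz : |z| < 1) :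
    HasSum (fun n : ℕ ↦ (ascPochhammer ℝ n).eval a / n.factorial * z ^ n) ((1 - z) ^ (-a)) := by
  have := (one_div_one_sub_rpow_hasFPowerSeriesOnBall_zero a).hasSum (y := z) (by
    simpa [Metric.mem_eball, edist_zero_right, ← ofReal_norm, ENNReal.ofReal_lt_one] using hz)
  have hpos : 0 < 1 - z := by linarith [(abs_lt.mp hz).2]
  simpa [FormalMultilinearSeries.ofScalars_apply_eq, choose_add_natCast_sub_one,
    Real.rpow_neg hpos.le, mul_comm] using this

/-- Euler's integral representation of `₂F₁(a, b; 1; z)`. -/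
theorem hyp2F1_eq_integral (a : ℝ) {b z : ℝ} (hb : 0 < b) (hb1 : b < 1) (hz : |z| < 1) :
    hyp2F1 a b 1 z = sin (π * b) / π *
      ∫ v in Ioo (0 : ℝ) 1, v ^ (b - 1) * (1 - v) ^ (-b) * (1 - z * v) ^ (-a) := by
  set c : ℕ → ℝ := fun n ↦ (ascPochhammer ℝ n).eval a / n.factorial * z ^ n
  set w : ℝ → ℝ := fun v ↦ v ^ (b - 1) * (1 - v) ^ (1 - b - 1)
  have hw : IntegrableOn w (Ioo 0 1) := integrableOn_beta hb (by linarith)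
  have hwn (n : ℕ) : EqOn (fun v : ℝ ↦ v ^ (n + b - 1) * (1 - v) ^ (1 - b - 1))
      (fun v ↦ v ^ n * w v) (Ioo 0 1) := fun v hv ↦ by
    simp only [w]
    rw [add_sub_assoc, Real.rpow_add hv.1, Real.rpow_natCast]
    ring
  have hint (n : ℕ) : IntegrableOn (fun v ↦ c n * (v ^ n * w v)) (Ioo 0 1) :=
    ((integrableOn_congr_fun (hwn n) measurableSet_Ioo).mp
      (integrableOn_beta (by positivity) (by linarith))).const_mul _
  have hc : Summable fun n ↦ ‖c n‖ := (hasSum_one_sub_rpow_neg a hz).summable.norm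
  have hwpos : ∀ v ∈ Ioo (0 : ℝ) 1, 0 ≤ w v := fun v hv ↦
    mul_nonneg (Real.rpow_nonneg hv.1.le _) (Real.rpow_nonneg (by linarith [hv.2]) _)
  have hsum : Summable fun n ↦ ∫ v in Ioo (0 : ℝ) 1, ‖c n * (v ^ n * w v)‖ := by
    refine (hc.mul_right (∫ v in Ioo (0 : ℝ) 1, w v)).of_nonneg_of_le
      (fun n ↦ integral_nonneg fun v ↦ norm_nonneg _) fun n ↦ ?_
    rw [← integral_const_mul]
    refine setIntegral_mono_on (hint n).norm (hw.const_mul _) measurableSet_Ioo fun v hv ↦ ?_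
    rw [norm_mul, norm_of_nonneg (mul_nonneg (pow_nonneg hv.1.le n) (hwpos v hv))]
    gcongr
    exact mul_le_of_le_one_left (hwpos v hv) (pow_le_one₀ hv.1.le hv.2.le)
  have h := hasSum_integral_of_summable_integral_norm hint hsum
  have hr : ∫ v in Ioo (0 : ℝ) 1, ∑' n, c n * (v ^ n * w v) =
      ∫ v in Ioo (0 : ℝ) 1, v ^ (b - 1) * (1 - v) ^ (-b) * (1 - z * v) ^ (-a) := by
    refine setIntegral_congr_fun measurableSet_Ioo fun v hv ↦ ?_
    have hzv : |z * v| < 1 := by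
      rw [abs_mul, abs_of_pos hv.1]
      exact mul_lt_one_of_nonneg_of_lt_one_left (abs_nonneg z) hz hv.2.le
    have := (hasSum_one_sub_rpow_neg a hzv).mul_left (w v)
    simp only [w] at this ⊢
    rw [sub_sub_cancel_left] at this ⊢
    rw [← this.tsum_eq]
    refine tsum_congr fun n ↦ ?_
    simp only [c, mul_pow]
    ring
  have hB : Gamma b * Gamma (1 - b) = π / sin (π * b) := Real.Gamma_mul_Gamma_one_sub b
  have hs : 0 < sin (π * b) := sin_pos_of_pos_of_lt_pi (by positivity) (by nlinarith [pi_pos])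
  rw [← hr, ← h.tsum_eq, ← tsum_mul_left, hyp2F1]
  refine tsum_congr fun n ↦ ?_
  rw [integral_const_mul, ← setIntegral_congr_fun measurableSet_Ioo (hwn n),
    integral_beta (by positivity) (by linarith), Gamma_natCast_add hb, mul_assoc _ (Gamma b), hB,
    show n + b + (1 - b) = n + 1 by ring, Gamma_nat_eq_factorial]
  have h1 : (ascPochhammer ℝ n).eval 1 = n.factorial := by
    rw [ascPochhammer_eval_one]
  rw [h1]
  simp only [c]
  field_simp

end EulerIntegral

section IcosahedralSubstitution

open Set

/-- The quartic form whose cube enters the icosahedral syzygy. -/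
noncomputable def icosQuartic (t : ℝ) : ℝ := 1 + 228 * t + 494 * t ^ 2 - 228 * t ^ 3 + t ^ 4

/-- The sextic form whose square enters the icosahedral syzygy. -/
noncomputable def icosSextic (t : ℝ) : ℝ :=
  1 - 522 * t - 10005 * t ^ 2 - 10005 * t ^ 4 + 522 * t ^ 5 + t ^ 6

/-- The icosahedral syzygy. -/
theorem icos_syzygy (t : ℝ) :
    icosQuartic t ^ 3 - icosSextic t ^ 2 = 1728 * t * (1 - 11 * t - t ^ 2) ^ 5 := by
  simp only [icosQuartic, icosSextic]
  ring

theorem icosQuartic_pos {t : ℝ} (h0 : 0 ≤ t) (h1 : t ≤ 1) : 0 < icosQuartic t := by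
  have : t ^ 2 * t ≤ t ^ 2 * 1 := by gcongr
  have : 0 ≤ t ^ 4 := by positivity
  simp only [icosQuartic]
  nlinarith

/-- The function `-Q / P ^ (3 / 2)` with `P` the icosahedral quartic and `Q` the sextic. -/
noncomputable def icosRatio (t : ℝ) : ℝ := -icosSextic t / icosQuartic t ^ (3 / 2 : ℝ)

theorem hasDerivAt_icosRatio {t : ℝ} (ht : 0 < icosQuartic t) :
    HasDerivAt icosRatio
      (864 * (1 - 11 * t - t ^ 2) ^ 4 / icosQuartic t ^ (5 / 2 : ℝ)) t := by
  have hP : HasDerivAt icosQuartic (228 + 988 * t - 684 * t ^ 2 + 4 * t ^ 3) t := by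
    have := (((((hasDerivAt_id t).const_mul 228).const_add 1).add
      ((hasDerivAt_pow 2 t).const_mul 494)).sub ((hasDerivAt_pow 3 t).const_mul 228)).add
      (hasDerivAt_pow 4 t)
    refine this.congr_deriv ?_
    norm_num
    ring
  have hQ : HasDerivAt icosSextic
      (-522 - 20010 * t - 40020 * t ^ 3 + 2610 * t ^ 4 + 6 * t ^ 5) t := by
    have := ((((((hasDerivAt_id t).const_mul 522).const_sub 1).sub
      ((hasDerivAt_pow 2 t).const_mul 10005)).sub ((hasDerivAt_pow 4 t).const_mul 10005)).add
      ((hasDerivAt_pow 5 t).const_mul 522)).add (hasDerivAt_pow 6 t)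
    refine this.congr_deriv ?_
    norm_num
    ring
  refine (hQ.neg.div (hP.rpow_const (p := 3 / 2) (.inl ht.ne'))
    (Real.rpow_pos_of_pos ht _).ne').congr_deriv ?_
  have hs := Real.rpow_pos_of_pos ht (1 / 2)
  have h3 : icosQuartic t ^ (3 / 2 : ℝ) = icosQuartic t * icosQuartic t ^ (1 / 2 : ℝ) := by
    rw [← Real.rpow_one_add' ht.le (by norm_num)]; norm_num
  have h5 : icosQuartic t ^ (5 / 2 : ℝ) = icosQuartic t ^ 2 * icosQuartic t ^ (1 / 2 : ℝ) := by
    rw [← Real.rpow_natCast, ← Real.rpow_add ht]; norm_num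
  rw [show (3 / 2 - 1 : ℝ) = 1 / 2 by norm_num, h3, h5]
  field_simp
  simp only [Pi.neg_apply, icosQuartic, icosSextic]
  ring

theorem one_sub_icosRatio_sq {t : ℝ} (ht : 0 < icosQuartic t) :
    1 - icosRatio t ^ 2 = 1728 * t * (1 - 11 * t - t ^ 2) ^ 5 / icosQuartic t ^ 3 := by
  have h3 : (icosQuartic t ^ (3 / 2 : ℝ)) ^ 2 = icosQuartic t ^ 3 := by
    rw [← Real.rpow_mul_natCast ht.le, ← Real.rpow_natCast]
    norm_num
  rw [icosRatio, div_pow, h3, ← icos_syzygy]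
  field_simp

theorem icosRatio_zero : icosRatio 0 = -1 := by
  simp [icosRatio, icosQuartic, icosSextic]

theorem icosRatio_root {r : ℝ} (hr0 : 0 < r) (hr1 : r ≤ 1) (hr : r ^ 2 + 11 * r = 1) :
    icosRatio r = 1 := by
  have hP := icosQuartic_pos hr0.le hr1
  have h2 : icosRatio r ^ 2 = 1 := by
    have := one_sub_icosRatio_sq hP
    rw [show 1 - 11 * r - r ^ 2 = 0 by linarith] at this
    simp at this
    linarith
  have hQ : icosSextic r = -15625 * r ^ 2 * (r ^ 2 + 1) := by
    simp only [icosSextic]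
    linear_combination (r ^ 4 + 511 * r ^ 3 + 511 * r - 1) * hr
  have : 0 ≤ icosRatio r := by
    rw [icosRatio, hQ]
    refine div_nonneg ?_ (Real.rpow_nonneg hP.le _)
    nlinarith [sq_nonneg r, sq_nonneg (r ^ 2)]
  exact (pow_eq_one_iff_of_nonneg this two_ne_zero).mp h2

theorem integral_one_sub_sq_rpow {r : ℝ} (hr0 : 0 < r) (hr : r ^ 2 + 11 * r = 1) :
    ∫ u in Ioo (-1 : ℝ) 1, (1 - u ^ 2) ^ (-5 / 6 : ℝ) =
      √3 * ∫ t in Ioo 0 r, t ^ (-5 / 6 : ℝ) * (1 - 11 * t - t ^ 2) ^ (-1 / 6 : ℝ) := by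
  have hr1 : r ≤ 1 := by nlinarith
  have hP : ∀ t ∈ Icc 0 r, 0 < icosQuartic t := fun t ht ↦
    icosQuartic_pos ht.1 (ht.2.trans hr1)
  have hD : ∀ t ∈ Ioo 0 r, 0 < 1 - 11 * t - t ^ 2 := fun t ht ↦ by nlinarith [ht.1, ht.2]
  rw [← setIntegral_deriv_mul_comp (f := icosRatio) isOpen_Ioo (convex_Ioo 0 r)
    (fun t ht ↦ hasDerivAt_icosRatio (hP t (Ioo_subset_Icc_self ht))) ?_ ?_ ?_
    (fun u ↦ (1 - u ^ 2) ^ (-5 / 6 : ℝ)), ← integral_const_mul]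
  · refine setIntegral_congr_fun measurableSet_Ioo fun t ht ↦ ?_
    have hp := hP t (Ioo_subset_Icc_self ht)
    have hd := hD t ht
    have ht0 := ht.1
    rw [one_sub_icosRatio_sq hp]
    set p := icosQuartic t
    set d := 1 - 11 * t - t ^ 2
    have hpp : (p ^ 3) ^ (-5 / 6 : ℝ) = (p ^ (5 / 2 : ℝ))⁻¹ := by
      rw [← Real.rpow_natCast, ← Real.rpow_mul hp.le, ← Real.rpow_neg hp.le]
      norm_num
    have hdd : d ^ 4 * (d ^ 5) ^ (-5 / 6 : ℝ) = d ^ (-1 / 6 : ℝ) := by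
      rw [← Real.rpow_natCast, ← Real.rpow_natCast, ← Real.rpow_mul hd.le, ← Real.rpow_add hd]
      norm_num
    rw [Real.div_rpow (by positivity) (by positivity), Real.mul_rpow (by positivity) (by positivity),
      Real.mul_rpow (by positivity) (by positivity), hpp, rpow_neg_five_sixths_1728, ← hdd]
    have := Real.rpow_pos_of_pos hp (5 / 2)
    field_simp
    norm_num
  · intro t ht
    have := Real.rpow_pos_of_pos (hP t (Ioo_subset_Icc_self ht)) (5 / 2)
    have := hD t ht
    positivity
  · intro t ht
    have h : 0 < 1 - icosRatio t ^ 2 := by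
      have := hP t (Ioo_subset_Icc_self ht)
      have := hD t ht
      have := ht.1
      rw [one_sub_icosRatio_sq ‹0 < icosQuartic t›]
      positivity
    exact abs_lt.mp ((sq_lt_one_iff_abs_lt_one _).mp (by linarith))
  · have := intermediate_value_Ioo hr0.le (f := icosRatio) fun t ht ↦
      (hasDerivAt_icosRatio (hP t ht)).continuousAt.continuousWithinAt
    rwa [icosRatio_zero, icosRatio_root hr0 hr1 hr] at this

theorem integral_rpow_mul_icosVertex_rpow {r : ℝ} (hr0 : 0 < r) (hr : r ^ 2 + 11 * r = 1) :
    ∫ t in Ioo 0 r, t ^ (-5 / 6 : ℝ) * (1 - 11 * t - t ^ 2) ^ (-1 / 6 : ℝ) =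
      r ^ (1 / 6 : ℝ) * ∫ v in Ioo (0 : ℝ) 1,
        v ^ (1 / 6 - 1 : ℝ) * (1 - v) ^ (-(1 / 6) : ℝ) * (1 - -r ^ 2 * v) ^ (-(1 / 6) : ℝ) := by
  rw [← setIntegral_deriv_mul_comp (f := fun v ↦ r * v) (f' := fun _ ↦ r) (I := Ioo 0 1)
    isOpen_Ioo (convex_Ioo 0 1) (fun v _ ↦ by simpa using (hasDerivAt_id v).const_mul r)
    (fun _ _ ↦ hr0) ?_ ?_ (fun t ↦ t ^ (-5 / 6 : ℝ) * (1 - 11 * t - t ^ 2) ^ (-1 / 6 : ℝ)),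
    ← integral_const_mul]
  · refine setIntegral_congr_fun measurableSet_Ioo fun v hv ↦ ?_
    have hv0 := hv.1
    rw [show 1 - 11 * (r * v) - (r * v) ^ 2 = (1 - v) * (1 - -r ^ 2 * v) by
      linear_combination -v * hr, Real.mul_rpow hr0.le hv0.le,
      Real.mul_rpow (by linarith [hv.2]) (by nlinarith [sq_nonneg r])]
    have h6 : r ^ (1 / 6 : ℝ) = r * r ^ (-5 / 6 : ℝ) := by
      rw [← Real.rpow_one_add' hr0.le (by norm_num)]; norm_num
    rw [h6]
    norm_num
    ring
  · intro v hv
    exact ⟨mul_pos hr0 hv.1, mul_lt_of_lt_one_right hr0 hv.2⟩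
  · intro t ht
    exact ⟨t / r, ⟨div_pos ht.1 hr0, (div_lt_one hr0).mpr ht.2⟩, by field_simp⟩

end IcosahedralSubstitution

theorem integral_eta4 :
    ∫ x in Set.Ioi (0 : ℝ), etaI x ^ 4 =
      (2 : ℝ) ^ (-(5 : ℝ) / 6) * (Real.sqrt 5 - 1) ^ ((5 : ℝ) / 6) *
        hyp2F1 (1 / 6) (1 / 6) 1 ((-123 + 55 * Real.sqrt 5) / 2) := by
  have h5 : √5 ^ 2 = 5 := Real.sq_sqrt (by norm_num)
  have h2 : 2.2 < √5 := Real.lt_sqrt_of_sq_lt (by norm_num)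
  have h3 : √5 < 2.3 := (Real.sqrt_lt' (by norm_num)).mpr (by norm_num)
  set r : ℝ := (5 * √5 - 11) / 2 with hrdef
  have hr0 : 0 < r := by linarith
  have hr : r ^ 2 + 11 * r = 1 := by
    rw [hrdef]
    linear_combination 25 / 4 * h5
  have hz : (-123 + 55 * √5) / 2 = -r ^ 2 := by
    rw [hrdef]
    linear_combination 25 / 4 * h5
  have hr5 : r = ((√5 - 1) / 2) ^ 5 := by
    rw [hrdef]
    linear_combination (-(√5 ^ 3 - 5 * √5 ^ 2 + 15 * √5 - 35) / 32) * h5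
  have hr6 : r ^ (1 / 6 : ℝ) = (2 : ℝ) ^ (-(5 : ℝ) / 6) * (√5 - 1) ^ ((5 : ℝ) / 6) := by
    rw [hr5, ← Real.rpow_natCast, ← Real.rpow_mul (by linarith),
      Real.div_rpow (by linarith) (by norm_num), neg_div, Real.rpow_neg (by norm_num)]
    norm_num
    ring
  rw [integral_etaI_pow_four, integral_one_sub_sq_rpow hr0 hr,
    integral_rpow_mul_icosVertex_rpow hr0 hr, hz,
    hyp2F1_eq_integral (1 / 6) (by norm_num) (by norm_num)
      (by rw [abs_neg, abs_of_pos (by positivity)]; nlinarith), ← hr6,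
    show π * (1 / 6) = π / 6 by ring, Real.sin_pi_div_six]
  generalize integral (volume.restrict (Set.Ioo (0 : ℝ) 1)) (_ : ℝ → ℝ) = J
  field_simp
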